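/- arXiv:1906.10611 — 2 statements merged into one kernel-verified Lean document; each statement's English description precedes it below -/
import Mathlib

section
/- For all natural numbers n ≥ 1 and 1 ≤ t ≤ 2ⁿ − 1, every eigenvalue λ of the difference matrix ρₙ := ρ_{(t,n,2)} − ρ_{(t,n,2ⁿ)} satisfies λ ≥ −t!/2^{tn}. -/
open MeasureTheory
open scoped BigOperators Classical

noncomputable section

/-- Bit strings of length `n`, i.e. elements of `{0,1}ⁿ`. -/
abbrev Str (n : ℕ) := Fin n → Bool

/-- Tuples of `t` strings from `{0,1}ⁿ`. -/
abbrev Tup (n t : ℕ) := Fin t → Str n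

/-- The binary phase state `|f⟩₂ = 2^{-n/2} Σ_x (-1)^{f(x)} |x⟩` for `f : {0,1}ⁿ → {0,1}`. -/
def ket2 (n : ℕ) (f : Str n → Bool) : Str n → ℂ :=
  fun x => (if f x then (-1 : ℂ) else 1) / Real.sqrt (2 ^ n)

/-- The `t`-fold tensor-power outer product `(v v†)^{⊗ t}` of a vector `v ∈ ℂ^{2ⁿ}`,
as a `2^{tn} × 2^{tn}` matrix indexed by tuples in `({0,1}ⁿ)ᵗ`. -/
def outerT (n t : ℕ) (v : Str n → ℂ) : Matrix (Tup n t) (Tup n t) ℂ :=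
  Matrix.of fun x y => (∏ i, v (x i)) * (starRingEnd ℂ) (∏ i, v (y i))

/-- `ρ_{(t,n,2)}`: the `t`-copy random binary phase mixed state, the expectation of
`(|f⟩₂⟨f|₂)^{⊗t}` over a uniformly random `f : {0,1}ⁿ → {0,1}`. -/
def rho2 (n t : ℕ) : Matrix (Tup n t) (Tup n t) ℂ :=
  (Fintype.card (Str n → Bool) : ℂ)⁻¹ • ∑ f : Str n → Bool, outerT n t (ket2 n f)

/-- The complex phase state `|f⟩_{2ⁿ} = 2^{-n/2} Σ_x ω^{f(x)} |x⟩`, `ω = e^{2πi/2ⁿ}`,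
for `f : {0,1}ⁿ → {0,…,2ⁿ-1}`. -/
def ketC (n : ℕ) (f : Str n → Fin (2 ^ n)) : Str n → ℂ :=
  fun x => Complex.exp (2 * Real.pi * Complex.I * ((f x : ℕ) : ℂ) / (2 ^ n)) / Real.sqrt (2 ^ n)

/-- `ρ_{(t,n,2ⁿ)}`: the `t`-copy random complex phase mixed state, the expectation of
`(|f⟩_{2ⁿ}⟨f|_{2ⁿ})^{⊗t}` over a uniformly random `f : {0,1}ⁿ → {0,…,2ⁿ-1}`. -/
def rhoC (n t : ℕ) : Matrix (Tup n t) (Tup n t) ℂ :=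
  (Fintype.card (Str n → Fin (2 ^ n)) : ℂ)⁻¹ • ∑ f : Str n → Fin (2 ^ n), outerT n t (ketC n f)

/-- Schur test for quadratic forms: if the entries of `A` are dominated by those of a symmetric real
matrix whose row sums are at most `K`, then the quadratic form of `A` is at most `K ‖v‖²`. -/
theorem re_dotProduct_mulVec_le_of_rowSum_le {ι : Type*} [Fintype ι] (A : Matrix ι ι ℂ)
    (B : ι → ι → ℝ) (K : ℝ) (hAB : ∀ x y, ‖A x y‖ ≤ B x y) (hB : ∀ x y, B x y = B y x)
    (hK : ∀ x, ∑ y, B x y ≤ K) (v : ι → ℂ) :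
    (star v ⬝ᵥ A.mulVec v).re ≤ K * ∑ x, ‖v x‖ ^ 2 := by
  have hsplit : ∑ x, ∑ y, B x y * ‖v y‖ ^ 2 = ∑ x, ∑ y, B x y * ‖v x‖ ^ 2 := by
    rw [Finset.sum_comm]
    exact Finset.sum_congr rfl fun x _ => Finset.sum_congr rfl fun y _ => by rw [hB]
  calc (star v ⬝ᵥ A.mulVec v).re
      ≤ ‖star v ⬝ᵥ A.mulVec v‖ := Complex.re_le_norm _
    _ ≤ ∑ x, ∑ y, ‖v x‖ * (‖A x y‖ * ‖v y‖) := by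
        refine (norm_sum_le _ _).trans (Finset.sum_le_sum fun x _ => ?_)
        rw [norm_mul, Pi.star_apply, norm_star, ← Finset.mul_sum]
        gcongr
        refine (norm_sum_le _ _).trans (Finset.sum_le_sum fun y _ => ?_)
        rw [norm_mul]
    _ ≤ ∑ x, ∑ y, (B x y * ‖v x‖ ^ 2 + B x y * ‖v y‖ ^ 2) / 2 := by
        refine Finset.sum_le_sum fun x _ => Finset.sum_le_sum fun y _ => ?_
        have hB0 : 0 ≤ B x y := (norm_nonneg _).trans (hAB x y)
        have h1 : ‖v x‖ * (‖A x y‖ * ‖v y‖) ≤ ‖v x‖ * (B x y * ‖v y‖) := by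
          gcongr
          exact hAB x y
        nlinarith [mul_nonneg hB0 (sq_nonneg (‖v x‖ - ‖v y‖))]
    _ = ∑ x, ∑ y, B x y * ‖v x‖ ^ 2 := by
        simp only [← Finset.sum_div, Finset.sum_add_distrib]
        rw [hsplit]
        ring
    _ ≤ ∑ x, K * ‖v x‖ ^ 2 := by
        refine Finset.sum_le_sum fun x _ => ?_
        rw [← Finset.sum_mul]
        exact mul_le_mul_of_nonneg_right (hK x) (sq_nonneg _)
    _ = K * ∑ x, ‖v x‖ ^ 2 := (Finset.mul_sum _ _ _).symm

/-- Two families in which every value occurs equally often differ by a permutation of the index. -/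
theorem exists_perm_comp_eq_of_card_fiber_eq {ι α : Type*} [Finite ι] (x y : ι → α)
    (h : ∀ s, Nat.card {i // x i = s} = Nat.card {i // y i = s}) :
    ∃ σ : Equiv.Perm ι, x ∘ σ = y := by
  let e : ∀ s, {i // y i = s} ≃ {i // x i = s} := fun s =>
    (Finite.card_eq.1 (h s).symm).some
  refine ⟨(Equiv.sigmaFiberEquiv y).symm.trans
    ((Equiv.sigmaCongrRight e).trans (Equiv.sigmaFiberEquiv x)), ?_⟩
  funext i
  exact (e (y i) ⟨i, rfl⟩).2

/-- At most `t!` families are rearrangements of a given family of length `t`. -/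
theorem card_filter_perm_comp_eq_le {α : Type*} [Fintype α] (t : ℕ) (x : Fin t → α)
    [DecidablePred fun y : Fin t → α => ∃ σ : Equiv.Perm (Fin t), x ∘ σ = y] :
    (Finset.univ.filter fun y : Fin t → α => ∃ σ : Equiv.Perm (Fin t), x ∘ σ = y).card
      ≤ t.factorial := by
  calc _ ≤ ((Finset.univ : Finset (Equiv.Perm (Fin t))).image fun σ : Equiv.Perm (Fin t) => x ∘ σ).card := by
        refine Finset.card_le_card fun y hy => ?_
        simpa using hy
    _ ≤ (Finset.univ : Finset (Equiv.Perm (Fin t))).card := Finset.card_image_le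
    _ = t.factorial := by rw [Finset.card_univ, Fintype.card_perm, Fintype.card_fin]

open scoped ComplexOrder in
theorem outerT_posSemidef (n t : ℕ) (v : Str n → ℂ) : (outerT n t v).PosSemidef :=
  Matrix.posSemidef_vecMulVec_self_star fun x : Tup n t => ∏ i, v (x i)

open scoped ComplexOrder in
theorem rho2_posSemidef (n t : ℕ) : (rho2 n t).PosSemidef :=
  (Matrix.posSemidef_sum _ fun f _ => outerT_posSemidef n t (ket2 n f)).smul
    (inv_nonneg.2 (Nat.cast_nonneg _))

theorem re_dotProduct_rho2_mulVec_nonneg (n t : ℕ) (v : Tup n t → ℂ) :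
    0 ≤ (star v ⬝ᵥ (rho2 n t).mulVec v).re :=
  (rho2_posSemidef n t).re_dotProduct_nonneg v

theorem norm_ketC (n : ℕ) (f : Str n → Fin (2 ^ n)) (x : Str n) :
    ‖ketC n f x‖ = (Real.sqrt (2 ^ n))⁻¹ := by
  have h : 2 * (Real.pi : ℂ) * Complex.I * ((f x : ℕ) : ℂ) / 2 ^ n
      = ((2 * Real.pi * ((f x : ℕ) : ℝ) / 2 ^ n : ℝ) : ℂ) * Complex.I := by
    push_cast
    ring
  rw [ketC, h, norm_div, Complex.norm_exp_ofReal_mul_I, Complex.norm_real, Real.norm_eq_abs,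
    abs_of_nonneg (Real.sqrt_nonneg _), one_div]

theorem norm_outerT_ketC (n t : ℕ) (f : Str n → Fin (2 ^ n)) (x y : Tup n t) :
    ‖outerT n t (ketC n f) x y‖ = ((2 : ℝ) ^ (t * n))⁻¹ := by
  have hs : Real.sqrt (2 ^ n) * Real.sqrt (2 ^ n) = 2 ^ n := Real.mul_self_sqrt (by positivity)
  simp only [outerT, Matrix.of_apply, norm_mul, RCLike.norm_conj, norm_prod, norm_ketC,
    Finset.prod_const, Finset.card_univ, Fintype.card_fin]
  rw [← mul_pow, ← mul_inv, hs, inv_pow, ← pow_mul, mul_comm n t]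

theorem norm_rhoC_apply_le (n t : ℕ) (x y : Tup n t) :
    ‖rhoC n t x y‖ ≤ ((2 : ℝ) ^ (t * n))⁻¹ := by
  have hpos : (0 : ℝ) < Fintype.card (Str n → Fin (2 ^ n)) := by
    exact_mod_cast Fintype.card_pos
  rw [rhoC, Matrix.smul_apply, Matrix.sum_apply, norm_smul, norm_inv, Complex.norm_natCast,
    inv_mul_le_iff₀ hpos]
  refine (norm_sum_le _ _).trans ?_
  simp only [norm_outerT_ketC, Finset.sum_const, Finset.card_univ, nsmul_eq_mul, le_refl]

theorem ketC_add_single (n : ℕ) (f : Str n → Fin (2 ^ n)) (s x : Str n) :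
    ketC n (f + Pi.single s 1) x
      = (if x = s then Complex.exp (2 * Real.pi * Complex.I / (2 ^ n : ℕ)) else 1)
        * ketC n f x := by
  have hω := Complex.isPrimitiveRoot_exp (2 ^ n) (by positivity)
  have hpow : ∀ k : ℕ, Complex.exp (2 * Real.pi * Complex.I * (k : ℂ) / 2 ^ n)
      = Complex.exp (2 * Real.pi * Complex.I / (2 ^ n : ℕ)) ^ k := by
    intro k
    rw [← Complex.exp_nat_mul]
    congr 1
    push_cast
    ring
  by_cases h : x = s
  · subst h
    have hval : ((f x + 1 : Fin (2 ^ n)) : ℕ) = ((f x : ℕ) + 1) % 2 ^ n := by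
      rw [Fin.val_add, Fin.coe_ofNat_eq_mod, Nat.add_mod_mod]
    simp only [ketC, hpow, Pi.add_apply, Pi.single_eq_same, if_true, hval]
    rw [← pow_eq_pow_mod _ hω.pow_eq_one, pow_succ]
    ring
  · simp [ketC, h]

theorem prod_ketC_add_single (n t : ℕ) (f : Str n → Fin (2 ^ n)) (s : Str n) (x : Tup n t) :
    ∏ i, ketC n (f + Pi.single s 1) (x i)
      = Complex.exp (2 * Real.pi * Complex.I / (2 ^ n : ℕ)) ^ Nat.card {i // x i = s}
        * ∏ i, ketC n f (x i) := by
  simp only [ketC_add_single, Finset.prod_mul_distrib, Finset.prod_ite, Finset.prod_const,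
    one_pow, mul_one, Nat.card_eq_fintype_card, Fintype.card_subtype]

/-- The entry of `ρ_{(t,n,2ⁿ)}` at `(x, y)` vanishes unless `y` is a rearrangement of `x`. -/
theorem exists_perm_of_rhoC_apply_ne_zero (n t : ℕ) (ht : t < 2 ^ n) (x y : Tup n t)
    (h : rhoC n t x y ≠ 0) : ∃ σ : Equiv.Perm (Fin t), x ∘ σ = y := by
  refine exists_perm_comp_eq_of_card_fiber_eq x y fun s => ?_
  set ω := Complex.exp (2 * Real.pi * Complex.I / (2 ^ n : ℕ)) with hω_def
  have hω : IsPrimitiveRoot ω (2 ^ n) := Complex.isPrimitiveRoot_exp (2 ^ n) (by positivity)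
  have hlt : ∀ z : Tup n t, Nat.card {i // z i = s} < 2 ^ n := fun z =>
    ((Finite.card_subtype_le _).trans_eq (Nat.card_fin t)).trans_lt ht
  refine hω.pow_inj (hlt x) (hlt y) ?_
  set a := Nat.card {i // x i = s}
  set b := Nat.card {i // y i = s}
  rw [rhoC, Matrix.smul_apply, Matrix.sum_apply, smul_eq_mul] at h
  have hS := right_ne_zero_of_mul h
  have hshift : ∑ f, outerT n t (ketC n f) x y
      = ω ^ a * (starRingEnd ℂ) (ω ^ b) * ∑ f, outerT n t (ketC n f) x y := by
    conv_lhs => rw [← Equiv.sum_comp (Equiv.addRight (Pi.single s (1 : Fin (2 ^ n))))]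
    rw [Finset.mul_sum]
    refine Finset.sum_congr rfl fun f _ => ?_
    simp only [outerT, Matrix.of_apply, Equiv.coe_addRight, prod_ketC_add_single, map_mul]
    ring
  have h1 : ω ^ a * (starRingEnd ℂ) (ω ^ b) = 1 :=
    mul_right_cancel₀ hS (by rw [one_mul]; exact hshift.symm)
  have hnorm : (starRingEnd ℂ) (ω ^ b) * ω ^ b = 1 := by
    rw [mul_comm, Complex.mul_conj, Complex.normSq_eq_norm_sq, norm_pow,
      hω.norm'_eq_one (by positivity)]
    simp
  calc ω ^ a = ω ^ a * ((starRingEnd ℂ) (ω ^ b) * ω ^ b) := by rw [hnorm, mul_one]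
    _ = ω ^ b := by rw [← mul_assoc, h1, one_mul]

theorem re_dotProduct_rhoC_mulVec_le (n t : ℕ) (ht : t < 2 ^ n) (v : Tup n t → ℂ) :
    (star v ⬝ᵥ (rhoC n t).mulVec v).re ≤ t.factorial / 2 ^ (t * n) * ∑ x, ‖v x‖ ^ 2 := by
  refine re_dotProduct_mulVec_le_of_rowSum_le _ (fun x y =>
    if ∃ σ : Equiv.Perm (Fin t), x ∘ σ = y then ((2 : ℝ) ^ (t * n))⁻¹ else 0) _
    (fun x y => ?_) (fun x y => ?_) (fun x => ?_) v
  · split_ifs with hxy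
    · exact norm_rhoC_apply_le n t x y
    · rw [norm_le_zero_iff]
      by_contra h
      exact hxy (exists_perm_of_rhoC_apply_ne_zero n t ht x y h)
  · have hsymm : ∀ z w : Tup n t, (∃ σ : Equiv.Perm (Fin t), z ∘ σ = w) →
        ∃ σ : Equiv.Perm (Fin t), w ∘ σ = z := by
      rintro z _ ⟨σ, rfl⟩
      exact ⟨σ⁻¹, by funext i; simp⟩
    split_ifs with hxy hyx hyx
    · rfl
    · exact absurd (hsymm x y hxy) hyx
    · exact absurd (hsymm y x hyx) hxy
    · rfl
  · rw [← Finset.sum_filter, Finset.sum_const, nsmul_eq_mul, div_eq_mul_inv]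
    gcongr
    exact card_filter_perm_comp_eq_le t x

/-- For `n ≥ 1` and `1 ≤ t ≤ 2ⁿ - 1`, every eigenvalue `λ` of
`ρₙ = ρ_{(t,n,2)} - ρ_{(t,n,2ⁿ)}` satisfies `λ ≥ -t!/2^{tn}`. -/
theorem eigenvalue_lower_bound (n t : ℕ) (hn : 1 ≤ n) (ht1 : 1 ≤ t) (ht2 : t ≤ 2 ^ n - 1)
    (h : (rho2 n t - rhoC n t).IsHermitian) (i : Tup n t) :
    -((t.factorial : ℝ) / 2 ^ (t * n)) ≤ h.eigenvalues i := by
  rw [h.eigenvalues_eq, Matrix.sub_mulVec, dotProduct_sub, map_sub]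
  have hlt : t < 2 ^ n := by
    have := Nat.one_le_two_pow (n := n)
    omega
  have hunit : ∑ x, ‖h.eigenvectorBasis i x‖ ^ 2 = 1 := by
    rw [← EuclideanSpace.norm_sq_eq, h.eigenvectorBasis.orthonormal.1 i, one_pow]
  have h2 := re_dotProduct_rho2_mulVec_nonneg n t (h.eigenvectorBasis i)
  have hC := re_dotProduct_rhoC_mulVec_le n t hlt (h.eigenvectorBasis i)
  rw [hunit, mul_one] at hC
  simp only [RCLike.re_to_complex] at h2 ⊢
  linarith
end
end

section
/- Let n ≥ 1 and 1 ≤ t ≤ 2ⁿ − 1, and let ρₙ := ρ_{(t,n,2)} − ρ_{(t,n,2ⁿ)}. Let 𝒜 := {−|P|/2^{tn} : P a permutation class} ∪ {0}. Then for every real λ ∉ 𝒜, det(ρₙ − λI) = ∏_S [ (−λ)^{|S| − k_S} · ∏_{i=1}^{k_S − 1} (−λ − |P_i^S|/2^{tn}) · ( −λ + (λ + |P_{k_S}^S|/2^{tn}) · Σ_{i=1}^{k_S − 1} (|P_i^S|/2^{tn}) / (λ + |P_i^S|/2^{tn}) ) ], where the product runs over all stabilization classes S, P_1^S,…,P_{k_S}^S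 are the permutation classes contained in S, and P_{k_S}^S is the permutation class containing the lexicographically largest element of S. -/
open MeasureTheory
open scoped BigOperators Classical

noncomputable section

/-- Tuples `x, y ∈ ({0,1}ⁿ)ᵗ` are permutations of each other: some `π ∈ S_t` maps one to
the other (equivalently, the multisets of their entries coincide). -/
def IsPerm (n t : ℕ) (x y : Tup n t) : Prop :=
  ∃ π : Equiv.Perm (Fin t), ∀ i, x i = y (π i)

/-- Tuples `x, y ∈ ({0,1}ⁿ)ᵗ` are stabilizations of each other: every string `s ∈ {0,1}ⁿ`
occurs an even number of times in the concatenated tuple `(x₁,…,x_t,y₁,…,y_t)`. -/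
def IsStab (n t : ℕ) (x y : Tup n t) : Prop :=
  ∀ s : Str n, Even ((Finset.univ.filter fun i => x i = s).card +
    (Finset.univ.filter fun i => y i = s).card)

/-- `x, y` are remote stabilizations of each other: stabilizations but not permutations. -/
def IsRemoteStab (n t : ℕ) (x y : Tup n t) : Prop :=
  IsStab n t x y ∧ ¬ IsPerm n t x y

/-- The permutation class of `x`: all tuples that are permutations of `x`. -/
def permClass (n t : ℕ) (x : Tup n t) : Finset (Tup n t) :=
  Finset.univ.filter fun y => IsPerm n t x y

/-- The stabilization class of `x`: all tuples that are stabilizations of `x`. -/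
def stabClass (n t : ℕ) (x : Tup n t) : Finset (Tup n t) :=
  Finset.univ.filter fun y => IsStab n t x y

/-- The numerical value of a tuple `x ∈ ({0,1}ⁿ)ᵗ` read as one long binary string
(most significant bit on the left); comparing these values is exactly the lexicographic
order on tuples. -/
def tupVal {n t : ℕ} (x : Tup n t) : ℕ :=
  ∑ i : Fin t,
    (∑ j : Fin n, if x i j then 2 ^ (n - 1 - (j : ℕ)) else 0) * (2 ^ n) ^ (t - 1 - (i : ℕ))

/-- `x` is the sentinel (lexicographically largest element) of its permutation class. -/
def IsPermSentinel (n t : ℕ) (x : Tup n t) : Prop :=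
  ∀ y : Tup n t, IsPerm n t x y → tupVal y ≤ tupVal x

/-- `x` is the sentinel (lexicographically largest element) of its stabilization class. -/
def IsStabSentinel (n t : ℕ) (x : Tup n t) : Prop :=
  ∀ y : Tup n t, IsStab n t x y → tupVal y ≤ tupVal x

/-- One representative (the sentinel) for each stabilization class. -/
def stabReps (n t : ℕ) : Finset (Tup n t) :=
  Finset.univ.filter fun x => IsStabSentinel n t x

/-- For a stabilization-class sentinel `x`, one representative (the permutation-class
sentinel) for each permutation class contained in the stabilization class of `x` other than
the permutation class of `x` itself. -/
def otherPermReps (n t : ℕ) (x : Tup n t) : Finset (Tup n t) :=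
  Finset.univ.filter fun y =>
    IsStab n t x y ∧ IsPermSentinel n t y ∧ ¬ IsPerm n t x y

/-- The normalized size `|P|/2^{tn}` of the permutation class of `y`. -/
def relSize (n t : ℕ) (y : Tup n t) : ℝ :=
  ((permClass n t y).card : ℝ) / 2 ^ (t * n)

/-- The set `𝒜` of negative relative sizes of permutation classes, together with `0`. -/
def Acal (n t : ℕ) : Set ℝ :=
  insert 0 {r : ℝ | ∃ x : Tup n t, r = -(relSize n t x)}

/-- The factor of the determinant formula coming from the stabilization class `S` of a
stabilization-class sentinel `x`: with `k_S` permutation classes `P_1, …, P_{k_S}` in `S`,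
where `P_{k_S}` is the class of the lexicographically largest element `x` of `S`, it equals
`(-λ)^{|S|-k_S} · ∏_{i=1}^{k_S-1}(-λ - |P_i|/2^{tn}) ·
  (-λ + (λ + |P_{k_S}|/2^{tn}) · Σ_{i=1}^{k_S-1} (|P_i|/2^{tn})/(λ + |P_i|/2^{tn}))`. -/
def stabClassFactor (n t : ℕ) (lam : ℝ) (x : Tup n t) : ℝ :=
  (-lam) ^ ((stabClass n t x).card - (1 + (otherPermReps n t x).card)) *
    (∏ y ∈ otherPermReps n t x, (-lam - relSize n t y)) *
    (-lam + (lam + relSize n t x) *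
      ∑ y ∈ otherPermReps n t x, relSize n t y / (lam + relSize n t y))

theorem Matrix.det_indicator_sub_indicator_sub {X ι κ : Type*} [Fintype X] [Fintype ι]
    [Fintype κ] [DecidableEq X] [DecidableEq ι] [DecidableEq κ] {K : Type*} [Field K]
    (p : X → ι) (s : X → κ) (hps : ∀ x y, p x = p y → s x = s y) (c lam : K) (hlam : lam ≠ 0)
    (hp : ∀ x, lam + c * (Finset.univ.filter fun y => p y = p x).card ≠ 0) :
    (Matrix.of fun x y : X => c * (if s x = s y then 1 else 0) - c * (if p x = p y then 1 else 0)
      - lam * (if x = y then 1 else 0)).det =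
      (-lam) ^ Fintype.card X *
        (∏ i, (1 + c * (Finset.univ.filter fun x => p x = i).card / lam)) *
        ∏ k, (1 - ∑ x with s x = k,
          c / (lam + c * (Finset.univ.filter fun y => p y = p x).card)) := by
  set U : Matrix X ι K := Matrix.of fun x i => if p x = i then 1 else 0 with hU
  set V : Matrix X κ K := Matrix.of fun x k => if s x = k then 1 else 0 with hV
  set W : Matrix X κ K := Matrix.of fun x k => if s x = k then
    -(lam + c * (Finset.univ.filter fun y => p y = p x).card)⁻¹ else 0 with hW
  set A : Matrix X X K := (-lam) • (1 + U * ((c / lam) • U.transpose)) with hA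
  have hUU : ∀ x y, (U * U.transpose) x y = if p x = p y then 1 else 0 := by
    intro x y
    simp [hU, Matrix.mul_apply, eq_comm]
  have hVV : ∀ x y, (V * V.transpose) x y = if s x = s y then 1 else 0 := by
    intro x y
    simp [hV, Matrix.mul_apply, eq_comm]
  have hA_apply : ∀ x y, A x y =
      -lam * (if x = y then 1 else 0) - c * (if p x = p y then 1 else 0) := by
    intro x y
    rw [hA, Matrix.mul_smul, Matrix.smul_apply, Matrix.add_apply, Matrix.smul_apply, hUU,
      Matrix.one_apply, smul_eq_mul, smul_eq_mul]
    field_simp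
    ring
  have hAW : A * W = V := by
    ext x k
    have hterm : ∀ y, A x y * W y k = -lam * (if x = y then W x k else 0)
        - c * (if p y = p x then W x k else 0) := by
      intro y
      rw [hA_apply]
      by_cases hxy : x = y
      · subst hxy
        simp
        ring
      · by_cases hpxy : p x = p y
        · have hWxy : W y k = W x k := by simp [hW, hpxy, hps x y hpxy]
          simp [hxy, hpxy, hWxy]
        · simp [hxy, hpxy, Ne.symm hpxy]
    rw [Matrix.mul_apply, Finset.sum_congr rfl fun y _ => hterm y, Finset.sum_sub_distrib,
      ← Finset.mul_sum, ← Finset.mul_sum, Finset.sum_ite_eq, ← Finset.sum_filter,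
      Finset.sum_const, nsmul_eq_mul]
    simp only [Finset.mem_univ, if_true, hW, hV, Matrix.of_apply]
    split_ifs
    · have := hp x
      field_simp
      ring
    · simp
  have hM : (Matrix.of fun x y : X => c * (if s x = s y then 1 else 0)
      - c * (if p x = p y then 1 else 0) - lam * (if x = y then 1 else 0)) =
      A * (1 + W * (c • V.transpose)) := by
    rw [mul_add, mul_one, ← Matrix.mul_assoc, hAW, Matrix.mul_smul]
    ext x y
    rw [Matrix.add_apply, Matrix.smul_apply, hVV, hA_apply, Matrix.of_apply, smul_eq_mul]
    ring
  have hUtU : 1 + (c / lam) • U.transpose * U =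
      Matrix.diagonal fun i => 1 + c * (Finset.univ.filter fun x => p x = i).card / lam := by
    ext i j
    rw [Matrix.add_apply, Matrix.smul_mul, Matrix.smul_apply, Matrix.mul_apply,
      Matrix.diagonal_apply, Matrix.one_apply]
    by_cases hij : i = j
    · subst hij
      simp [hU, mul_div_right_comm, ← ite_and]
    · simp only [hij, if_false, hU, Matrix.transpose_apply, Matrix.of_apply, zero_add, smul_eq_mul]
      rw [Finset.sum_eq_zero, mul_zero]
      intro x _
      grind
  have hVtW : 1 + c • V.transpose * W =
      Matrix.diagonal fun k => 1 - ∑ x with s x = k,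
          c / (lam + c * (Finset.univ.filter fun y => p y = p x).card) := by
    ext k l
    rw [Matrix.add_apply, Matrix.smul_mul, Matrix.smul_apply, Matrix.mul_apply,
      Matrix.diagonal_apply, Matrix.one_apply]
    by_cases hkl : k = l
    · subst hkl
      simp only [if_true, sub_eq_add_neg, add_right_inj, Finset.sum_filter, smul_eq_mul,
        Finset.mul_sum, ← Finset.sum_neg_distrib]
      refine Finset.sum_congr rfl fun x _ => ?_
      simp only [hV, hW, Matrix.transpose_apply, Matrix.of_apply]
      split_ifs <;> simp [div_eq_mul_inv]
    · simp only [hkl, if_false, hV, hW, Matrix.transpose_apply, Matrix.of_apply, zero_add,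
        smul_eq_mul]
      rw [Finset.sum_eq_zero, mul_zero]
      intro x _
      grind
  rw [hM, Matrix.det_mul, Matrix.det_one_add_mul_comm, hVtW, Matrix.det_diagonal, hA,
    Matrix.det_smul, Matrix.det_one_add_mul_comm, hUtU, Matrix.det_diagonal]

/-- The number of positions at which the string `s` occurs in the tuple `x`. -/
def occ {n t : ℕ} (x : Tup n t) (s : Str n) : ℕ := (Finset.univ.filter fun i => x i = s).card

theorem occ_le {n t : ℕ} (x : Tup n t) (s : Str n) : occ x s ≤ t :=
  (Finset.card_filter_le _ _).trans (by simp)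

theorem prod_eq_prod_pow_occ {n t : ℕ} {M : Type*} [CommMonoid M] (x : Tup n t) (g : Str n → M) :
    ∏ i, g (x i) = ∏ s, g s ^ occ x s := by
  simp_rw [occ, ← Finset.prod_const, Finset.prod_fiberwise' Finset.univ x g]

theorem isPerm_iff_occ {n t : ℕ} (x y : Tup n t) : IsPerm n t x y ↔ occ x = occ y := by
  constructor
  · rintro ⟨π, hπ⟩
    funext s
    exact Finset.card_equiv π fun i => by simp [hπ]
  · intro h
    have e (s : Str n) : {i // x i = s} ≃ {i // y i = s} :=
      Fintype.equivOfCardEq (by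
        rw [Fintype.card_subtype, Fintype.card_subtype]
        exact congrFun h s)
    exact ⟨Equiv.ofFiberEquiv e, fun i => (Equiv.ofFiberEquiv_map e i).symm⟩

/-- The permutation relation as a setoid. -/
def permSetoid (n t : ℕ) : Setoid (Tup n t) where
  r := IsPerm n t
  iseqv := by
    refine ⟨fun x => ?_, fun {x y} h => ?_, fun {x y z} h₁ h₂ => ?_⟩ <;>
      rw [isPerm_iff_occ] at *
    · exact h.symm
    · exact h₁.trans h₂

/-- The stabilization relation as a setoid. -/
def stabSetoid (n t : ℕ) : Setoid (Tup n t) where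
  r := IsStab n t
  iseqv := by
    refine ⟨fun x s => Even.add_self _, fun {x y} h s => ?_, fun {x y z} h₁ h₂ s => ?_⟩
    · rw [add_comm]
      exact h s
    · have h₁ := h₁ s
      have h₂ := h₂ s
      rw [Nat.even_add] at h₁ h₂ ⊢
      exact h₁.trans h₂

theorem permSetoid_le_stabSetoid (n t : ℕ) : permSetoid n t ≤ stabSetoid n t := by
  intro x y h s
  have h := congrFun ((isPerm_iff_occ x y).1 h) s
  rw [occ, occ] at h
  rw [h]
  exact Even.add_self _

theorem expect_outerT {n t : ℕ} {B : Type*} [Fintype B] (z : B → ℂ) :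
    (Fintype.card (Str n → B) : ℂ)⁻¹ •
        ∑ f : Str n → B, outerT n t (fun s => z (f s) / Real.sqrt (2 ^ n)) =
      Matrix.of fun x y => (2 ^ (t * n))⁻¹ *
        ∏ s, ((Fintype.card B : ℂ)⁻¹ * ∑ b, z b ^ occ x s * (starRingEnd ℂ) (z b) ^ occ y s) := by
  have hsqrt : ((Real.sqrt (2 ^ n) : ℝ) : ℂ) ^ t * ((Real.sqrt (2 ^ n) : ℝ) : ℂ) ^ t =
      2 ^ (t * n) := by
    rw [← mul_pow, mul_comm t n, pow_mul]
    norm_cast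
    rw [Real.mul_self_sqrt (by positivity)]
    norm_cast
  ext x y
  have hterm (f : Str n → B) : outerT n t (fun s => z (f s) / Real.sqrt (2 ^ n)) x y =
      (2 ^ (t * n))⁻¹ * ∏ s, (z (f s) ^ occ x s * (starRingEnd ℂ) (z (f s)) ^ occ y s) := by
    simp only [outerT, Matrix.of_apply, map_prod, map_div₀, map_pow, Complex.conj_ofReal,
      Finset.prod_div_distrib, Finset.prod_const, Finset.card_univ, Fintype.card_fin]
    rw [prod_eq_prod_pow_occ x fun s => z (f s),
      prod_eq_prod_pow_occ y fun s => (starRingEnd ℂ) (z (f s)), Finset.prod_mul_distrib,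
      ← hsqrt, div_mul_div_comm, div_eq_inv_mul]
  rw [Matrix.smul_apply, Matrix.sum_apply, Finset.sum_congr rfl fun f _ => hterm f,
    ← Finset.mul_sum, Matrix.of_apply, Finset.prod_mul_distrib, Finset.prod_const,
    Fintype.prod_sum fun s b => z b ^ occ x s * (starRingEnd ℂ) (z b) ^ occ y s,
    Fintype.card_fun, Finset.card_univ, smul_eq_mul]
  push_cast
  rw [inv_pow]
  ring

theorem Finset.prod_ite_one_zero_eq {ι R : Type*} [CommMonoidWithZero R] (s : Finset ι)
    (P : ι → Prop) [DecidablePred P] [Decidable (∀ i ∈ s, P i)] :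
    (∏ i ∈ s, if P i then (1 : R) else 0) = if ∀ i ∈ s, P i then 1 else 0 := by
  split_ifs with h
  · exact Finset.prod_eq_one fun i hi => if_pos (h i hi)
  · push Not at h
    obtain ⟨i, hi, hPi⟩ := h
    exact Finset.prod_eq_zero hi (if_neg hPi)

theorem rho2_eq (n t : ℕ) :
    rho2 n t = Matrix.of fun x y => (2 ^ (t * n))⁻¹ * if IsStab n t x y then 1 else 0 := by
  have hmean (a b : ℕ) : (Fintype.card Bool : ℂ)⁻¹ * ∑ c : Bool,
      (if c then (-1 : ℂ) else 1) ^ a * (starRingEnd ℂ) (if c then (-1 : ℂ) else 1) ^ b =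
      if Even (a + b) then 1 else 0 := by
    rw [Fintype.card_bool, Fintype.sum_bool]
    simp only [if_true, Bool.false_eq_true, if_false, map_neg, map_one, one_pow, ← pow_add]
    split_ifs with h
    · norm_num [h.neg_one_pow]
    · norm_num [(Nat.not_even_iff_odd.1 h).neg_one_pow]
  refine (expect_outerT fun c : Bool => if c then (-1 : ℂ) else 1).trans ?_
  ext x y
  rw [Matrix.of_apply, Matrix.of_apply, Finset.prod_congr rfl fun s _ => hmean (occ x s) (occ y s),
    Finset.prod_ite_one_zero_eq]
  simp only [Finset.mem_univ, true_imp_iff]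
  exact congrArg _ (if_congr Iff.rfl rfl rfl)

theorem IsPrimitiveRoot.mean_pow_mul_conj_pow {N : ℕ} {ζ : ℂ} (hζ : IsPrimitiveRoot ζ N)
    {a b : ℕ} (ha : a < N) (hb : b < N) :
    (N : ℂ)⁻¹ * ∑ k : Fin N, (ζ ^ (k : ℕ)) ^ a * (starRingEnd ℂ) (ζ ^ (k : ℕ)) ^ b =
      if a = b then 1 else 0 := by
  have hN : N ≠ 0 := by omega
  have hconj : (starRingEnd ℂ) ζ = ζ⁻¹ :=
    (Complex.inv_eq_conj (Complex.norm_eq_one_of_pow_eq_one hζ.pow_eq_one hN)).symm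
  have hζ0 : ζ ≠ 0 := hζ.ne_zero hN
  have hterm (k : ℕ) : (ζ ^ k) ^ a * (starRingEnd ℂ) (ζ ^ k) ^ b = (ζ ^ a * (ζ ^ b)⁻¹) ^ k := by
    rw [map_pow, hconj, mul_pow, ← inv_pow, pow_right_comm ζ, pow_right_comm ζ⁻¹]
  simp_rw [hterm]
  rw [Fin.sum_univ_eq_sum_range fun k => (ζ ^ a * (ζ ^ b)⁻¹) ^ k]
  split_ifs with hab
  · subst hab
    simp [hζ0, hN]
  · have hne : ζ ^ a * (ζ ^ b)⁻¹ ≠ 1 := by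
      intro h
      exact hab (hζ.pow_inj ha hb ((mul_inv_eq_one₀ (pow_ne_zero _ hζ0)).1 h))
    have hpow : (ζ ^ a * (ζ ^ b)⁻¹) ^ N = 1 := by
      rw [mul_pow, inv_pow, pow_right_comm ζ a, pow_right_comm ζ b, hζ.pow_eq_one]
      simp
    rw [geom_sum_eq hne, hpow]
    simp

theorem rhoC_eq {n t : ℕ} (ht : t < 2 ^ n) :
    rhoC n t = Matrix.of fun x y => (2 ^ (t * n))⁻¹ * if IsPerm n t x y then 1 else 0 := by
  have hζ := Complex.isPrimitiveRoot_exp (2 ^ n) (by positivity)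
  set ζ := Complex.exp (2 * Real.pi * Complex.I / (2 ^ n : ℕ)) with hζ_def
  have hket (f : Str n → Fin (2 ^ n)) :
      ketC n f = fun s => ζ ^ (f s : ℕ) / Real.sqrt (2 ^ n) := by
    funext s
    rw [ketC, hζ_def, ← Complex.exp_nat_mul]
    push_cast
    ring_nf
  have hmean (x y : Tup n t) (s : Str n) := hζ.mean_pow_mul_conj_pow
    ((occ_le x s).trans_lt ht) ((occ_le y s).trans_lt ht)
  rw [rhoC, funext hket]
  refine (expect_outerT fun k : Fin (2 ^ n) => ζ ^ (k : ℕ)).trans ?_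
  ext x y
  rw [Matrix.of_apply, Matrix.of_apply, Fintype.card_fin,
    Finset.prod_congr rfl fun s _ => hmean x y s, Finset.prod_ite_one_zero_eq]
  simp only [Finset.mem_univ, true_imp_iff, isPerm_iff_occ, funext_iff]

theorem Nat.sum_mul_pow_rev_injective (b k : ℕ) :
    Function.Injective fun d : Fin k → Fin b => ∑ i, (d i : ℕ) * b ^ (k - 1 - (i : ℕ)) := by
  intro d e h
  have hrev (f : Fin k → Fin b) : ∑ i, (f i : ℕ) * b ^ (k - 1 - (i : ℕ)) =
      finFunctionFinEquiv (f ∘ Fin.rev) := by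
    rw [finFunctionFinEquiv_apply, ← Equiv.sum_comp Fin.revPerm]
    refine Finset.sum_congr rfl fun i _ => ?_
    simp only [Fin.revPerm_apply, Function.comp_apply, Fin.val_rev]
    congr 2
    omega
  simp only [hrev] at h
  exact Fin.rev_surjective.injective_comp_right (finFunctionFinEquiv.injective (Fin.ext h))

/-- The numerical value of a bit string, with the most significant bit on the left. -/
def strVal {n : ℕ} (s : Str n) : ℕ := ∑ j : Fin n, if s j then 2 ^ (n - 1 - (j : ℕ)) else 0

theorem strVal_injective (n : ℕ) : Function.Injective (strVal (n := n)) := by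
  intro s u h
  have hdigit (v : Str n) : strVal v =
      ∑ j, ((if v j then 1 else 0 : Fin 2) : ℕ) * 2 ^ (n - 1 - (j : ℕ)) := by
    refine Finset.sum_congr rfl fun j _ => ?_
    split_ifs <;> simp
  rw [hdigit, hdigit] at h
  funext j
  have := congrFun (Nat.sum_mul_pow_rev_injective 2 n h) j
  revert this
  cases s j <;> cases u j <;> simp

theorem strVal_lt {n : ℕ} (s : Str n) : strVal s < 2 ^ n := by
  have hle : strVal s ≤ ∑ j : Fin n, 2 ^ (n - 1 - (j : ℕ)) :=
    Finset.sum_le_sum fun j _ => by split_ifs <;> simp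
  rw [Fin.sum_univ_eq_sum_range fun j => 2 ^ (n - 1 - j), Finset.sum_range_reflect fun j => 2 ^ j,
    Nat.geomSum_eq le_rfl] at hle
  have := Nat.one_le_two_pow (n := n)
  omega

theorem tupVal_injective (n t : ℕ) : Function.Injective (tupVal (n := n) (t := t)) := by
  intro x y h
  have := Nat.sum_mul_pow_rev_injective (2 ^ n) t
    (a₁ := fun i => ⟨strVal (x i), strVal_lt _⟩) (a₂ := fun i => ⟨strVal (y i), strVal_lt _⟩) h
  funext i
  exact strVal_injective n (Fin.ext_iff.1 (congrFun this i))

/-- The element of the class of `x` with the largest value of `v`. -/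
def Setoid.sentinel {X : Type*} [Fintype X] (r : Setoid X) (v : X → ℕ) (x : X) : X :=
  (Finset.exists_max_image (Finset.univ.filter fun y => r x y) v ⟨x, by simp⟩).choose

section Sentinel

variable {X : Type*} [Fintype X] (r : Setoid X) (v : X → ℕ)

theorem Setoid.rel_sentinel (x : X) : r x (r.sentinel v x) := by
  have h := (Finset.exists_max_image (Finset.univ.filter fun y => r x y) v
    ⟨x, by simp⟩).choose_spec.1
  exact (Finset.mem_filter.1 h).2

theorem Setoid.le_sentinel {x y : X} (h : r x y) : v y ≤ v (r.sentinel v x) :=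
  (Finset.exists_max_image (Finset.univ.filter fun y => r x y) v
    ⟨x, by simp⟩).choose_spec.2 y (by simp [h])

variable {v}

theorem Setoid.sentinel_eq_iff (hv : Function.Injective v) {x y : X} :
    r.sentinel v x = y ↔ r x y ∧ ∀ z, r y z → v z ≤ v y := by
  constructor
  · rintro rfl
    exact ⟨r.rel_sentinel v x, fun z hz => r.le_sentinel v (r.trans (r.rel_sentinel v x) hz)⟩
  · rintro ⟨hxy, hy⟩
    exact hv (le_antisymm (hy _ (r.trans (r.symm hxy) (r.rel_sentinel v x))) (r.le_sentinel v hxy))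

theorem Setoid.sentinel_eq_sentinel_iff (hv : Function.Injective v) {x y : X} :
    r.sentinel v x = r.sentinel v y ↔ r x y := by
  rw [r.sentinel_eq_iff hv]
  constructor
  · exact fun h => r.trans h.1 (r.symm (r.rel_sentinel v y))
  · exact fun h => ⟨r.trans h (r.rel_sentinel v y), ((r.sentinel_eq_iff hv).1 rfl).2⟩

end Sentinel

theorem neg_pow_mul_prod_one_add_div_mul {ι K : Type*} [Field K] (O : Finset ι) (q : ι → K)
    {lam a : K} (hlam : lam ≠ 0) (ha : lam + a ≠ 0) (σ : K) {m : ℕ} (hm : 1 + O.card ≤ m) :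
    (-lam) ^ m * ((1 + a / lam) * ∏ y ∈ O, (1 + q y / lam)) * (1 - (a / (lam + a) + σ)) =
      (-lam) ^ (m - (1 + O.card)) * (∏ y ∈ O, (-lam - q y)) * (-lam + (lam + a) * σ) := by
  have hprod : ∏ y ∈ O, (-lam - q y) = (-lam) ^ O.card * ∏ y ∈ O, (1 + q y / lam) := by
    rw [← Finset.prod_const, ← Finset.prod_mul_distrib]
    refine Finset.prod_congr rfl fun y _ => ?_
    field_simp
    ring
  obtain ⟨d, rfl⟩ := Nat.exists_eq_add_of_le hm
  have hd : 1 + O.card + d - (1 + O.card) = d := by omega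
  rw [hprod, hd]
  field_simp
  ring

section Classes

variable {n t : ℕ}

/-- The sentinel of the permutation class of `x`. -/
def permSentinel (x : Tup n t) : Tup n t := (permSetoid n t).sentinel tupVal x

/-- The sentinel of the stabilization class of `x`. -/
def stabSentinel (x : Tup n t) : Tup n t := (stabSetoid n t).sentinel tupVal x

theorem permSentinel_eq_iff {x y : Tup n t} :
    permSentinel x = y ↔ IsPerm n t x y ∧ IsPermSentinel n t y :=
  (permSetoid n t).sentinel_eq_iff (tupVal_injective n t)

theorem stabSentinel_eq_iff {x y : Tup n t} :
    stabSentinel x = y ↔ IsStab n t x y ∧ IsStabSentinel n t y :=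
  (stabSetoid n t).sentinel_eq_iff (tupVal_injective n t)

theorem permSentinel_eq_permSentinel_iff {x y : Tup n t} :
    permSentinel x = permSentinel y ↔ IsPerm n t x y :=
  (permSetoid n t).sentinel_eq_sentinel_iff (tupVal_injective n t)

theorem stabSentinel_eq_stabSentinel_iff {x y : Tup n t} :
    stabSentinel x = stabSentinel y ↔ IsStab n t x y :=
  (stabSetoid n t).sentinel_eq_sentinel_iff (tupVal_injective n t)

theorem IsPerm.symm {x y : Tup n t} (h : IsPerm n t x y) : IsPerm n t y x :=
  (permSetoid n t).symm h

theorem IsStab.symm {x y : Tup n t} (h : IsStab n t x y) : IsStab n t y x :=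
  (stabSetoid n t).symm h

theorem IsStab.trans {x y z : Tup n t} (h : IsStab n t x y) (h' : IsStab n t y z) :
    IsStab n t x z :=
  (stabSetoid n t).trans h h'

theorem IsPerm.isStab {x y : Tup n t} (h : IsPerm n t x y) : IsStab n t x y :=
  permSetoid_le_stabSetoid n t h

theorem IsStabSentinel.isPermSentinel {x : Tup n t} (h : IsStabSentinel n t x) :
    IsPermSentinel n t x :=
  fun y hy => h y hy.isStab

theorem stabSentinel_mem_stabReps (x : Tup n t) : stabSentinel x ∈ stabReps n t :=
  Finset.mem_filter.2 ⟨Finset.mem_univ _, (stabSentinel_eq_iff.1 rfl).2⟩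

theorem filter_permSentinel_eq_permSentinel (x : Tup n t) :
    (Finset.univ.filter fun y => permSentinel y = permSentinel x) = permClass n t x := by
  ext y
  rw [Finset.mem_filter_univ, permSentinel_eq_permSentinel_iff, permClass, Finset.mem_filter_univ]
  exact ⟨IsPerm.symm, IsPerm.symm⟩

theorem filter_stabSentinel_eq {x : Tup n t} (hx : IsStabSentinel n t x) :
    (Finset.univ.filter fun y => stabSentinel y = x) = stabClass n t x := by
  ext y
  rw [Finset.mem_filter_univ, stabSentinel_eq_iff, stabClass, Finset.mem_filter_univ]
  exact ⟨fun h => h.1.symm, fun h => ⟨h.symm, hx⟩⟩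

theorem relSize_eq_of_isPerm {x y : Tup n t} (h : IsPerm n t x y) :
    relSize n t x = relSize n t y := by
  rw [relSize, relSize, ← filter_permSentinel_eq_permSentinel,
    ← filter_permSentinel_eq_permSentinel, permSentinel_eq_permSentinel_iff.2 h]

theorem notMem_otherPermReps (x : Tup n t) : x ∉ otherPermReps n t x := fun h =>
  (Finset.mem_filter.1 h).2.2.2 ((permSetoid n t).refl x)

theorem mem_insert_otherPermReps {x y : Tup n t} (hx : IsStabSentinel n t x) :
    y ∈ insert x (otherPermReps n t x) ↔ IsStab n t x y ∧ IsPermSentinel n t y := by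
  rw [Finset.mem_insert, otherPermReps, Finset.mem_filter_univ]
  constructor
  · rintro (rfl | h)
    · exact ⟨(stabSetoid n t).refl y, hx.isPermSentinel⟩
    · exact ⟨h.1, h.2.1⟩
  · rintro ⟨h₁, h₂⟩
    by_cases h : IsPerm n t x y
    · left
      exact (permSentinel_eq_iff.2 ⟨h, h₂⟩).symm.trans
        (permSentinel_eq_iff.2 ⟨(permSetoid n t).refl x, hx.isPermSentinel⟩)
    · exact Or.inr ⟨h₁, h₂, h⟩

theorem one_add_card_otherPermReps_le {x : Tup n t} (hx : IsStabSentinel n t x) :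
    1 + (otherPermReps n t x).card ≤ (stabClass n t x).card := by
  rw [add_comm, ← Finset.card_insert_of_notMem (notMem_otherPermReps x)]
  refine Finset.card_le_card fun y hy => ?_
  rw [stabClass, Finset.mem_filter_univ]
  exact ((mem_insert_otherPermReps hx).1 hy).1

theorem sum_stabClass_inv_add_relSize {x : Tup n t} (hx : IsStabSentinel n t x) (lam : ℝ) :
    ∑ z ∈ stabClass n t x, (2 ^ (t * n))⁻¹ / (lam + relSize n t z) =
      ∑ y ∈ insert x (otherPermReps n t x), relSize n t y / (lam + relSize n t y) := by
  have hmaps : ∀ z ∈ stabClass n t x, permSentinel z ∈ insert x (otherPermReps n t x) := by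
    intro z hz
    have hzs := permSentinel_eq_iff.1 (rfl : permSentinel z = permSentinel z)
    exact (mem_insert_otherPermReps hx).2
      ⟨(Finset.mem_filter.1 hz).2.trans hzs.1.isStab, hzs.2⟩
  rw [← Finset.sum_fiberwise_of_maps_to hmaps]
  refine Finset.sum_congr rfl fun y hy => ?_
  obtain ⟨hxy, hy⟩ := (mem_insert_otherPermReps hx).1 hy
  have hfiber : (stabClass n t x).filter (fun z => permSentinel z = y) = permClass n t y := by
    ext z
    rw [Finset.mem_filter, permSentinel_eq_iff, permClass, Finset.mem_filter_univ, stabClass,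
      Finset.mem_filter_univ]
    exact ⟨fun h => h.2.1.symm, fun h => ⟨hxy.trans h.isStab, h.symm, hy⟩⟩
  rw [hfiber, Finset.sum_congr rfl fun z hz => by
    rw [← relSize_eq_of_isPerm (Finset.mem_filter.1 hz).2], Finset.sum_const, nsmul_eq_mul,
    mul_div_assoc', ← div_eq_mul_inv, ← relSize]

theorem prod_one_add_card_div (lam : ℝ) :
    ∏ i : Tup n t, (1 + (2 ^ (t * n))⁻¹ *
        ((Finset.univ.filter fun x => permSentinel x = i).card : ℝ) / lam) =
      ∏ x ∈ stabReps n t, ∏ y ∈ insert x (otherPermReps n t x), (1 + relSize n t y / lam) := by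
  have hfiber : ∀ x ∈ stabReps n t, ((Finset.univ.filter (IsPermSentinel n t)).filter
      fun y => stabSentinel y = x) = insert x (otherPermReps n t x) := by
    intro x hx
    have hx := (Finset.mem_filter.1 hx).2
    ext y
    rw [mem_insert_otherPermReps hx, Finset.mem_filter, Finset.mem_filter_univ,
      stabSentinel_eq_iff]
    exact ⟨fun h => ⟨h.2.1.symm, h.1⟩, fun h => ⟨h.2, h.1.symm, hx⟩⟩
  symm
  rw [← Finset.prod_congr rfl fun x hx => congrArg (Finset.prod · _) (hfiber x hx),
    Finset.prod_fiberwise_of_maps_to fun y _ => stabSentinel_mem_stabReps y]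
  refine Finset.prod_subset_one_on_sdiff (Finset.subset_univ _) (fun y hy => ?_) fun y hy => ?_
  · have hempty : (Finset.univ.filter fun x => permSentinel x = y) = ∅ := by
      refine Finset.filter_eq_empty_iff.2 fun x _ hxy => ?_
      exact (Finset.mem_sdiff.1 hy).2 (Finset.mem_filter.2
        ⟨Finset.mem_univ _, (permSentinel_eq_iff.1 hxy).2⟩)
    simp [hempty]
  · have hy := permSentinel_eq_iff.2 ⟨(permSetoid n t).refl y, (Finset.mem_filter.1 hy).2⟩
    have hfilter := filter_permSentinel_eq_permSentinel y
    rw [hy] at hfilter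
    rw [hfilter, relSize, inv_mul_eq_div]

theorem card_tup_eq_sum_card_stabClass :
    Fintype.card (Tup n t) = ∑ x ∈ stabReps n t, (stabClass n t x).card := by
  rw [← Finset.card_univ,
    Finset.card_eq_sum_card_fiberwise fun x _ => stabSentinel_mem_stabReps x]
  exact Finset.sum_congr rfl fun x hx => by rw [filter_stabSentinel_eq (Finset.mem_filter.1 hx).2]

theorem prod_one_sub_sum_stabClass (lam : ℝ) :
    ∏ k : Tup n t, (1 - ∑ x with stabSentinel x = k, (2 ^ (t * n))⁻¹ / (lam + relSize n t x)) =
      ∏ x ∈ stabReps n t,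
        (1 - ∑ y ∈ insert x (otherPermReps n t x), relSize n t y / (lam + relSize n t y)) := by
  symm
  refine Finset.prod_subset_one_on_sdiff (Finset.subset_univ _) (fun y hy => ?_) fun y hy => ?_
  · rw [Finset.filter_eq_empty_iff.2, Finset.sum_empty, sub_zero]
    rintro x _ rfl
    exact (Finset.mem_sdiff.1 hy).2 (stabSentinel_mem_stabReps x)
  · have hy := (Finset.mem_filter.1 hy).2
    rw [filter_stabSentinel_eq hy, sum_stabClass_inv_add_relSize hy]

theorem det_isStab_sub_isPerm_sub {lam : ℝ} (hlam : lam ∉ Acal n t) :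
    (Matrix.of fun x y : Tup n t => (2 ^ (t * n))⁻¹ * (if IsStab n t x y then 1 else 0)
      - (2 ^ (t * n))⁻¹ * (if IsPerm n t x y then 1 else 0)
      - lam * (if x = y then 1 else 0)).det = ∏ x ∈ stabReps n t, stabClassFactor n t lam x := by
  have hlam0 : lam ≠ 0 := fun h => hlam (Or.inl h)
  have hrel (x : Tup n t) : lam + relSize n t x ≠ 0 := fun h =>
    hlam (Or.inr ⟨x, eq_neg_of_add_eq_zero_left h⟩)
  have hcard (x : Tup n t) : (2 ^ (t * n) : ℝ)⁻¹ *
      ((Finset.univ.filter fun y => permSentinel y = permSentinel x).card : ℝ) =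
      relSize n t x := by
    rw [filter_permSentinel_eq_permSentinel, relSize, inv_mul_eq_div]
  have hdet := Matrix.det_indicator_sub_indicator_sub (permSentinel (n := n) (t := t))
    stabSentinel (fun x y h => stabSentinel_eq_stabSentinel_iff.2
      (permSentinel_eq_permSentinel_iff.1 h).isStab) (2 ^ (t * n) : ℝ)⁻¹ lam hlam0
    fun x => by rw [hcard]; exact hrel x
  simp only [hcard] at hdet
  simp only [permSentinel_eq_permSentinel_iff, stabSentinel_eq_stabSentinel_iff] at hdet
  rw [hdet, prod_one_add_card_div, prod_one_sub_sum_stabClass, card_tup_eq_sum_card_stabClass,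
    ← Finset.prod_pow_eq_pow_sum, ← Finset.prod_mul_distrib, ← Finset.prod_mul_distrib]
  refine Finset.prod_congr rfl fun x hx => ?_
  rw [Finset.prod_insert (notMem_otherPermReps x), Finset.sum_insert (notMem_otherPermReps x)]
  exact neg_pow_mul_prod_one_add_div_mul _ _ hlam0 (hrel x) _
    (one_add_card_otherPermReps_le (Finset.mem_filter.1 hx).2)

end Classes

/-- For `n ≥ 1`, `1 ≤ t ≤ 2ⁿ - 1` and every real `λ ∉ 𝒜`,
`det(ρₙ - λI) = ∏_S [ (-λ)^{|S|-k_S} · ∏_{i=1}^{k_S-1}(-λ - |P_i^S|/2^{tn}) ·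
  (-λ + (λ + |P_{k_S}^S|/2^{tn}) · Σ_{i=1}^{k_S-1}(|P_i^S|/2^{tn})/(λ + |P_i^S|/2^{tn})) ]`,
the product running over all stabilization classes `S` (represented by their sentinels). -/
theorem det_rho_diff_sub_lambda (n t : ℕ) (hn : 1 ≤ n) (ht1 : 1 ≤ t) (ht2 : t ≤ 2 ^ n - 1)
    (lam : ℝ) (hlam : lam ∉ Acal n t) :
    ((rho2 n t - rhoC n t) - (lam : ℂ) • (1 : Matrix (Tup n t) (Tup n t) ℂ)).det =
      ((∏ x ∈ stabReps n t, stabClassFactor n t lam x : ℝ) : ℂ) := by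
  have hM : (rho2 n t - rhoC n t) - (lam : ℂ) • (1 : Matrix (Tup n t) (Tup n t) ℂ) =
      Complex.ofRealHom.mapMatrix (Matrix.of fun x y : Tup n t =>
        (2 ^ (t * n))⁻¹ * (if IsStab n t x y then 1 else 0)
        - (2 ^ (t * n))⁻¹ * (if IsPerm n t x y then 1 else 0)
        - lam * (if x = y then 1 else 0)) := by
    rw [rho2_eq, rhoC_eq (show t < 2 ^ n by omega)]
    ext x y
    rw [Matrix.sub_apply, Matrix.sub_apply, Matrix.smul_apply, Matrix.one_apply, Matrix.of_apply,
      Matrix.of_apply, RingHom.mapMatrix_apply, Matrix.map_apply, Matrix.of_apply, smul_eq_mul]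
    simp only [map_sub, map_mul, map_inv₀, map_pow, map_ofNat, apply_ite Complex.ofRealHom,
      map_one, map_zero, Complex.ofRealHom_eq_coe]
  rw [hM, ← RingHom.map_det, det_isStab_sub_isPerm_sub hlam]
  rfl
end
end
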